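/- arXiv:2306.03589 — 2 statements merged into one kernel-verified Lean document; each statement's English description precedes it below -/
import Mathlib

section
/- Let 0 < c₂ ≤ 1 and define |1−c₂λ*| := max_{1≤ℓ≤n−1} |1−c₂λ_ℓ|, which is < 1. Then for every integer N ≥ 1 and all nodes v,u ∈ V, −Σ_{ℓ=1}^{n−1} ((1−c₂λ_ℓ)^N/(c₂λ_ℓ)) φ_ℓ(v) φ_ℓ(u) ≤ (|1−c₂λ*|^N/(2c₂λ₁)) · ( 2 − d_v/(2|E|) − d_u/(2|E|) ). -/
open scoped BigOperators

noncomputable section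

namespace OSQ

variable {n d : ℕ}

/-- componentwise application of the activation function. -/
def act (σ : ℝ → ℝ) (x : EuclideanSpace ℝ (Fin d)) : EuclideanSpace ℝ (Fin d) :=
  WithLp.toLp 2 (fun i => σ (x i))

/-- node features computed by the MPNN after `t` layers. -/
def mpnn (σ : ℝ → ℝ) (𝒜 : Matrix (Fin n) (Fin n) ℝ)
    (Ω W : ℕ → EuclideanSpace ℝ (Fin d) →L[ℝ] EuclideanSpace ℝ (Fin d))
    (ψ : ℕ → EuclideanSpace ℝ (Fin d) × EuclideanSpace ℝ (Fin d) → EuclideanSpace ℝ (Fin d)) :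
    ℕ → (Fin n → EuclideanSpace ℝ (Fin d)) → Fin n → EuclideanSpace ℝ (Fin d)
  | 0, X, v => X v
  | (t+1), X, v =>
    act σ (Ω (t+1) (mpnn σ 𝒜 Ω W ψ t X v)
      + W (t+1) (∑ u : Fin n, 𝒜 v u • ψ (t+1) (mpnn σ 𝒜 Ω W ψ t X v, mpnn σ 𝒜 Ω W ψ t X u)))

/-- coordinate direction in the input space: a perturbation of entry `β` of the
feature of node `u`. -/
def dir (u : Fin n) (β : Fin d) : Fin n → EuclideanSpace ℝ (Fin d) :=
  Pi.single u (EuclideanSpace.single β 1)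

/-- `∂ h_v^{(m),α} / ∂ x_u^β`. -/
def jacEntry (σ : ℝ → ℝ) (𝒜 : Matrix (Fin n) (Fin n) ℝ)
    (Ω W : ℕ → EuclideanSpace ℝ (Fin d) →L[ℝ] EuclideanSpace ℝ (Fin d))
    (ψ : ℕ → EuclideanSpace ℝ (Fin d) × EuclideanSpace ℝ (Fin d) → EuclideanSpace ℝ (Fin d))
    (m : ℕ) (v u : Fin n) (X : Fin n → EuclideanSpace ℝ (Fin d)) (α β : Fin d) : ℝ :=
  fderiv ℝ (fun Y => mpnn σ 𝒜 Ω W ψ m Y v α) X (dir u β)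

/-- `∂² h_i^{(m),α} / ∂ x_v^β ∂ x_u^γ`. -/
def hessEntry (σ : ℝ → ℝ) (𝒜 : Matrix (Fin n) (Fin n) ℝ)
    (Ω W : ℕ → EuclideanSpace ℝ (Fin d) →L[ℝ] EuclideanSpace ℝ (Fin d))
    (ψ : ℕ → EuclideanSpace ℝ (Fin d) × EuclideanSpace ℝ (Fin d) → EuclideanSpace ℝ (Fin d))
    (m : ℕ) (i v u : Fin n) (X : Fin n → EuclideanSpace ℝ (Fin d)) (α β γ : Fin d) : ℝ :=
  fderiv ℝ (fun Y => fderiv ℝ (fun Z => mpnn σ 𝒜 Ω W ψ m Z i α) Y (dir u γ)) X (dir v β)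

/-- graph-level prediction with SUM readout: `y(X) = θᵀ Σ_v h_v^{(m)}`. -/
def readout (θ : EuclideanSpace ℝ (Fin d)) (σ : ℝ → ℝ) (𝒜 : Matrix (Fin n) (Fin n) ℝ)
    (Ω W : ℕ → EuclideanSpace ℝ (Fin d) →L[ℝ] EuclideanSpace ℝ (Fin d))
    (ψ : ℕ → EuclideanSpace ℝ (Fin d) × EuclideanSpace ℝ (Fin d) → EuclideanSpace ℝ (Fin d))
    (m : ℕ) (X : Fin n → EuclideanSpace ℝ (Fin d)) : ℝ :=
  ∑ α : Fin d, θ α * (∑ v : Fin n, mpnn σ 𝒜 Ω W ψ m X v) α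

/-- `∂² y^{(m)} / ∂ x_v^α ∂ x_u^β`. -/
def mixEntry (θ : EuclideanSpace ℝ (Fin d)) (σ : ℝ → ℝ) (𝒜 : Matrix (Fin n) (Fin n) ℝ)
    (Ω W : ℕ → EuclideanSpace ℝ (Fin d) →L[ℝ] EuclideanSpace ℝ (Fin d))
    (ψ : ℕ → EuclideanSpace ℝ (Fin d) × EuclideanSpace ℝ (Fin d) → EuclideanSpace ℝ (Fin d))
    (m : ℕ) (v u : Fin n) (X : Fin n → EuclideanSpace ℝ (Fin d)) (α β : Fin d) : ℝ :=
  fderiv ℝ (fun Y => fderiv ℝ (fun Z => readout θ σ 𝒜 Ω W ψ m Z) Y (dir u β)) X (dir v α)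

/-- the matrix `S := (ω/w)I + c₁ diag(𝒜 1) + c₂ 𝒜`. -/
def Smat (ω w c₁ c₂ : ℝ) (𝒜 : Matrix (Fin n) (Fin n) ℝ) : Matrix (Fin n) (Fin n) ℝ :=
  (ω / w) • (1 : Matrix (Fin n) (Fin n) ℝ)
    + c₁ • Matrix.diagonal (fun i => ∑ j, 𝒜 i j) + c₂ • 𝒜

/-- `diag(𝒜 1)` : the diagonal matrix of row sums. -/
def rowSumDiag (𝒜 : Matrix (Fin n) (Fin n) ℝ) : Matrix (Fin n) (Fin n) ℝ :=
  Matrix.diagonal (fun i => ∑ j, 𝒜 i j)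

/-- `diag(1ᵀ M)` : the diagonal matrix of column sums. -/
def colSumDiag (M : Matrix (Fin n) (Fin n) ℝ) : Matrix (Fin n) (Fin n) ℝ :=
  Matrix.diagonal (fun j => ∑ i, M i j)

/-- the operator (spectral) norm of a matrix, viewed as a linear map between
Euclidean spaces. -/
def matOpNorm {ι κ : Type*} [Fintype ι] [Fintype κ] [DecidableEq ι] (M : Matrix κ ι ℝ) : ℝ :=
  ‖LinearMap.toContinuousLinearMap (Matrix.toEuclideanLin M)‖


/-- the symmetrically-normalized adjacency matrix `A_sym := D^{-1/2} A D^{-1/2}`. -/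
def Asym (G : SimpleGraph (Fin n)) [DecidableRel G.Adj] : Matrix (Fin n) (Fin n) ℝ :=
  Matrix.diagonal (fun a => (Real.sqrt (G.degree a))⁻¹) * G.adjMatrix ℝ *
    Matrix.diagonal (fun a => (Real.sqrt (G.degree a))⁻¹)

/-- the random-walk normalized adjacency matrix `D^{-1} A`. -/
def Arw (G : SimpleGraph (Fin n)) [DecidableRel G.Adj] : Matrix (Fin n) (Fin n) ℝ :=
  Matrix.diagonal (fun a => ((G.degree a : ℝ))⁻¹) * G.adjMatrix ℝ
/-- the normalized graph Laplacian `Δ := I - A_sym`. -/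
def nLap (G : SimpleGraph (Fin n)) [DecidableRel G.Adj] : Matrix (Fin n) (Fin n) ℝ :=
  1 - Asym G

/-- the matrix `Z := I - c₂ Δ`. -/
def Zmat (c₂ : ℝ) (G : SimpleGraph (Fin n)) [DecidableRel G.Adj] : Matrix (Fin n) (Fin n) ℝ :=
  1 - c₂ • nLap G

/-- the commute time `τ(v,u) = 2|E| Σ_{ℓ≥1} (1/λ_ℓ)(φ_ℓ(v)/√d_v - φ_ℓ(u)/√d_u)²`,
expressed spectrally. -/
def commuteTime (G : SimpleGraph (Fin n)) [DecidableRel G.Adj]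
    (lam : Fin n → ℝ) (φ : Fin n → Fin n → ℝ) (v u : Fin n) : ℝ :=
  2 * (G.edgeFinset.card : ℝ) *
    ∑ ℓ ∈ Finset.univ.filter (fun ℓ : Fin n => (ℓ : ℕ) ≠ 0),
      (1 / lam ℓ) *
        (φ ℓ v / Real.sqrt (G.degree v) - φ ℓ u / Real.sqrt (G.degree u)) ^ 2

/-- the pseudo-inverse `Δ† := Σ_{ℓ≥1} (1/λ_ℓ) φ_ℓ φ_ℓᵀ` of the normalized Laplacian. -/
def nLapPinv (lam : Fin n → ℝ) (φ : Fin n → Fin n → ℝ) : Matrix (Fin n) (Fin n) ℝ :=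
  Matrix.of fun a b =>
    ∑ ℓ ∈ Finset.univ.filter (fun ℓ : Fin n => (ℓ : ℕ) ≠ 0), (1 / lam ℓ) * (φ ℓ a * φ ℓ b)
/-- bound on `−Σ_{ℓ≥1}((1−c₂λ_ℓ)^N/(c₂λ_ℓ))φ_ℓ(v)φ_ℓ(u)` via the
maximum `Λ = max_{ℓ≥1}|1−c₂λ_ℓ|`, which is `< 1`. -/
theorem spectral_remainder_bound (hn : 1 < n)
    (G : SimpleGraph (Fin n)) [DecidableRel G.Adj] (hconn : G.Connected)
    (c₂ : ℝ) (hc₂0 : 0 < c₂) (hc₂1 : c₂ ≤ 1)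
    (lam : Fin n → ℝ) (φ : Fin n → Fin n → ℝ)
    (horth : ∀ k l, ∑ a, φ k a * φ l a = if k = l then (1 : ℝ) else 0)
    (heig : ∀ ℓ, (nLap G).mulVec (φ ℓ) = lam ℓ • φ ℓ)
    (hmono : Monotone lam)
    (hlam0 : lam ⟨0, by omega⟩ = 0)
    (hlampos : ∀ ℓ : Fin n, (ℓ : ℕ) ≠ 0 → 0 < lam ℓ)
    (hlamlt : ∀ ℓ, lam ℓ < 2)
    (hφ0 : ∀ a, φ ⟨0, by omega⟩ a = Real.sqrt ((G.degree a : ℝ) / (2 * G.edgeFinset.card)))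
    (Λ : ℝ)
    (hΛ : IsGreatest {x : ℝ | ∃ ℓ : Fin n, (ℓ : ℕ) ≠ 0 ∧ x = |1 - c₂ * lam ℓ|} Λ)
    (N : ℕ) (hN : 1 ≤ N) (v u : Fin n) :
    Λ < 1 ∧
      -∑ ℓ ∈ Finset.univ.filter (fun ℓ : Fin n => (ℓ : ℕ) ≠ 0),
          ((1 - c₂ * lam ℓ) ^ N / (c₂ * lam ℓ)) * (φ ℓ v * φ ℓ u)
        ≤ Λ ^ N / (2 * c₂ * lam ⟨1, hn⟩) *
            (2 - (G.degree v : ℝ) / (2 * (G.edgeFinset.card : ℝ))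
               - (G.degree u : ℝ) / (2 * (G.edgeFinset.card : ℝ))) := by
  have hcol : ∀ a, ∑ ℓ, φ ℓ a * φ ℓ a = 1 := by
    intro a
    have h1 : (Matrix.of φ) * (Matrix.of φ).transpose = 1 := by
      ext k l
      rw [Matrix.mul_apply, Matrix.one_apply]
      simpa using horth k l
    have h2 : (Matrix.of φ).transpose * (Matrix.of φ) = 1 := mul_eq_one_comm.mp h1
    have h3 := congrFun (congrFun h2 a) a
    rw [Matrix.mul_apply, Matrix.one_apply] at h3
    simpa using h3
  have hfil : ∀ a, ∑ ℓ ∈ Finset.univ.filter (fun ℓ : Fin n => (ℓ : ℕ) ≠ 0), φ ℓ a * φ ℓ a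
      = 1 - (G.degree a : ℝ) / (2 * (G.edgeFinset.card : ℝ)) := by
    intro a
    have he : Finset.univ.filter (fun ℓ : Fin n => (ℓ : ℕ) ≠ 0)
        = Finset.univ.erase (⟨0, by omega⟩ : Fin n) := by
      ext ℓ
      simp [Fin.ext_iff]
    have h1 := Finset.add_sum_erase Finset.univ (fun ℓ => φ ℓ a * φ ℓ a)
      (Finset.mem_univ (⟨0, by omega⟩ : Fin n))
    have h2 : φ ⟨0, by omega⟩ a * φ ⟨0, by omega⟩ a
        = (G.degree a : ℝ) / (2 * (G.edgeFinset.card : ℝ)) := by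
      rw [hφ0 a]
      exact Real.mul_self_sqrt (by positivity)
    rw [he]
    have h3 := hcol a
    linarith
  constructor
  · obtain ⟨ℓ, hℓ, rfl⟩ := hΛ.1
    have h1 := hlampos ℓ hℓ
    have h2 := hlamlt ℓ
    rw [abs_lt]
    constructor <;> nlinarith
  have hl1 : 0 < lam ⟨1, hn⟩ := hlampos _ (by simp)
  have hR : Λ ^ N / (2 * c₂ * lam ⟨1, hn⟩) *
            (2 - (G.degree v : ℝ) / (2 * (G.edgeFinset.card : ℝ))
               - (G.degree u : ℝ) / (2 * (G.edgeFinset.card : ℝ)))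
      = ∑ ℓ ∈ Finset.univ.filter (fun ℓ : Fin n => (ℓ : ℕ) ≠ 0),
          Λ ^ N / (c₂ * lam ⟨1, hn⟩) * ((φ ℓ v * φ ℓ v + φ ℓ u * φ ℓ u) / 2) := by
    rw [← Finset.mul_sum, ← Finset.sum_div, Finset.sum_add_distrib, hfil, hfil]
    field_simp
    ring
  rw [hR, ← Finset.sum_neg_distrib]
  apply Finset.sum_le_sum
  intro ℓ hℓ
  have hℓ0 : (ℓ : ℕ) ≠ 0 := by simpa using hℓ
  have hpos := hlampos ℓ hℓ0
  have hle : lam ⟨1, hn⟩ ≤ lam ℓ := hmono (by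
    rw [Fin.le_def]
    exact Nat.one_le_iff_ne_zero.mpr hℓ0)
  have hΛℓ : |1 - c₂ * lam ℓ| ≤ Λ := hΛ.2 ⟨ℓ, hℓ0, rfl⟩
  have hΛ0 : 0 ≤ Λ := (abs_nonneg _).trans hΛℓ
  have hcoef : |(1 - c₂ * lam ℓ) ^ N / (c₂ * lam ℓ)| ≤ Λ ^ N / (c₂ * lam ⟨1, hn⟩) := by
    rw [abs_div, abs_pow, abs_of_pos (mul_pos hc₂0 hpos)]
    gcongr
  have hpq : |φ ℓ v * φ ℓ u| ≤ (φ ℓ v * φ ℓ v + φ ℓ u * φ ℓ u) / 2 := by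
    rw [abs_le]
    constructor <;> nlinarith [sq_nonneg (φ ℓ v - φ ℓ u), sq_nonneg (φ ℓ v + φ ℓ u)]
  calc _ ≤ |(1 - c₂ * lam ℓ) ^ N / (c₂ * lam ℓ) * (φ ℓ v * φ ℓ u)| := neg_le_abs _
    _ = |(1 - c₂ * lam ℓ) ^ N / (c₂ * lam ℓ)| * |φ ℓ v * φ ℓ u| := abs_mul _ _
    _ ≤ _ := mul_le_mul hcoef hpq (abs_nonneg _) ((abs_nonneg _).trans hcoef)
end OSQ
end
end

section
/- Let 𝖠 = A_sym, suppose |σ'|≤1, |σ''|≤1, c₂ > 0, and max{w, ω/w + c₁γ + c₂} ≤ 1, and define Z := I − c₂Δ and the Laplacian pseudo-inverse Δ† := Σ_{ℓ=1}^{n−1}(1/λ_ℓ)φ_ℓφ_ℓ^⊤. Then for all nodes v,u ∈ V, every input X, and all coordinates 1≤α,β≤d, |∂²y^{(m)}(X)/∂x_v^α∂x_u^β| ≤ γ·( m·√(d_v d_u)/(2|E|)·(1 + 2c^{(2)}(1+γ)) + (1/c₂)·(Z²(I−Z^{2m})(I+Z)^{−1}Δ†)_{vu} ) + 2(c^{(2)}/c₂)·γ·(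 ((1+γ)I − Δ)(I−Z^{2m})(I+Z)^{−1}Δ† )_{vu}. -/
open scoped BigOperators

noncomputable section

namespace OSQ

variable {n d : ℕ}

section Calculus

variable {E F F' : Type*} [NormedAddCommGroup E] [NormedSpace ℝ E]
  [NormedAddCommGroup F] [NormedSpace ℝ F] [NormedAddCommGroup F'] [NormedSpace ℝ F']

/-- mixed second directional derivative. -/
def sd (f : E → F) (X p q : E) : F := fderiv ℝ (fun Y => fderiv ℝ f Y p) X q

lemma diff_fd {f : E → F} (hf : ContDiff ℝ 2 f) (p : E) :
    Differentiable ℝ (fun Y => fderiv ℝ f Y p) := by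
  have h : ContDiff ℝ 1 (fderiv ℝ f) := hf.fderiv_right (by norm_num)
  exact (h.differentiable (by norm_num)).clm_apply (differentiable_const p)

lemma diff_of2 {f : E → F} (hf : ContDiff ℝ 2 f) : Differentiable ℝ f :=
  hf.differentiable (by norm_num)

lemma fd_clm (L : F →L[ℝ] F') {f : E → F} (hf : ContDiff ℝ 2 f) (X p : E) :
    fderiv ℝ (fun Y => L (f Y)) X p = L (fderiv ℝ f X p) := by
  have h : HasFDerivAt (fun Y => L (f Y)) _ X :=
    L.hasFDerivAt.comp X (diff_of2 hf X).hasFDerivAt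
  rw [h.fderiv]
  rfl

lemma sd_clm (L : F →L[ℝ] F') {f : E → F} (hf : ContDiff ℝ 2 f) (X p q : E) :
    sd (fun Y => L (f Y)) X p q = L (sd f X p q) := by
  unfold sd
  simp_rw [fd_clm L hf]
  have h : HasFDerivAt (fun Y => L (fderiv ℝ f Y p)) _ X :=
    L.hasFDerivAt.comp X (diff_fd hf p X).hasFDerivAt
  rw [h.fderiv]
  rfl

lemma fd_add {f g : E → F} (hf : ContDiff ℝ 2 f) (hg : ContDiff ℝ 2 g) (X p : E) :
    fderiv ℝ (fun Y => f Y + g Y) X p = fderiv ℝ f X p + fderiv ℝ g X p := by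
  rw [fderiv_fun_add (diff_of2 hf X) (diff_of2 hg X)]; rfl

lemma sd_add {f g : E → F} (hf : ContDiff ℝ 2 f) (hg : ContDiff ℝ 2 g) (X p q : E) :
    sd (fun Y => f Y + g Y) X p q = sd f X p q + sd g X p q := by
  unfold sd
  simp_rw [fd_add hf hg]
  rw [fderiv_fun_add (diff_fd hf p X) (diff_fd hg p X)]; rfl

lemma fd_sum {ι : Type*} (s : Finset ι) {f : ι → E → F} (hf : ∀ i, ContDiff ℝ 2 (f i)) (X p : E) :
    fderiv ℝ (fun Y => ∑ i ∈ s, f i Y) X p = ∑ i ∈ s, fderiv ℝ (f i) X p := by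
  rw [fderiv_fun_sum (fun i _ => diff_of2 (hf i) X)]
  simp

lemma sd_sum {ι : Type*} (s : Finset ι) {f : ι → E → F} (hf : ∀ i, ContDiff ℝ 2 (f i))
    (X p q : E) :
    sd (fun Y => ∑ i ∈ s, f i Y) X p q = ∑ i ∈ s, sd (f i) X p q := by
  unfold sd
  simp_rw [fd_sum s hf]
  rw [fderiv_fun_sum (fun i _ => diff_fd (hf i) p X)]
  simp

lemma fd_comp {g : F → F'} {f : E → F} (hg : ContDiff ℝ 2 g) (hf : ContDiff ℝ 2 f) (X p : E) :
    fderiv ℝ (fun Y => g (f Y)) X p = fderiv ℝ g (f X) (fderiv ℝ f X p) := by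
  have h : HasFDerivAt (fun Y => g (f Y)) _ X :=
    (diff_of2 hg (f X)).hasFDerivAt.comp X (diff_of2 hf X).hasFDerivAt
  rw [h.fderiv]
  rfl

lemma sd_comp {g : F → F'} {f : E → F} (hg : ContDiff ℝ 2 g) (hf : ContDiff ℝ 2 f) (X p q : E) :
    sd (fun Y => g (f Y)) X p q =
      iteratedFDeriv ℝ 2 g (f X) ![fderiv ℝ f X q, fderiv ℝ f X p]
        + fderiv ℝ g (f X) (sd f X p q) := by
  have h : ContDiff ℝ 1 (fderiv ℝ g) := hg.fderiv_right (by norm_num)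
  unfold sd
  simp_rw [fd_comp hg hf]
  have h1 : HasFDerivAt (fun Y => fderiv ℝ g (f Y)) _ X :=
    (h.differentiable (by norm_num) (f X)).hasFDerivAt.comp X (diff_of2 hf X).hasFDerivAt
  have h2 := h1.clm_apply (diff_fd hf p X).hasFDerivAt
  rw [h2.fderiv, iteratedFDeriv_two_apply]
  simp [add_comm]

lemma fd_prod {f : E → F} {g : E → F'} (hf : ContDiff ℝ 2 f) (hg : ContDiff ℝ 2 g) (X p : E) :
    fderiv ℝ (fun Y => (f Y, g Y)) X p = (fderiv ℝ f X p, fderiv ℝ g X p) := by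
  rw [((diff_of2 hf X).hasFDerivAt.prodMk (diff_of2 hg X).hasFDerivAt).fderiv]; rfl

lemma sd_prod {f : E → F} {g : E → F'} (hf : ContDiff ℝ 2 f) (hg : ContDiff ℝ 2 g) (X p q : E) :
    sd (fun Y => (f Y, g Y)) X p q = (sd f X p q, sd g X p q) := by
  unfold sd
  simp_rw [fd_prod hf hg]
  rw [((diff_fd hf p X).hasFDerivAt.prodMk (diff_fd hg p X).hasFDerivAt).fderiv]; rfl

lemma fd_partial {ψ : F × F → F'} (hψ : ContDiff ℝ 2 ψ) (x y a b : F) :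
    fderiv ℝ ψ (x, y) (a, b) =
      fderiv ℝ (fun z => ψ (z, y)) x a + fderiv ℝ (fun z => ψ (x, z)) y b := by
  have h := (diff_of2 hψ (x, y)).hasFDerivAt
  have h1 : HasFDerivAt (fun z => ψ (z, y)) _ x := h.comp x (hasFDerivAt_prodMk_left x y)
  have h2 : HasFDerivAt (fun z => ψ (x, z)) _ y := h.comp y (hasFDerivAt_prodMk_right x y)
  rw [h1.fderiv, h2.fderiv]
  simp [← map_add]

lemma act_contDiff {σ : ℝ → ℝ} (hσ : ContDiff ℝ 2 σ) :
    ContDiff ℝ 2 (act (d := d) σ) := by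
  rw [contDiff_euclidean]
  intro i
  have : ContDiff ℝ 2 (fun x : EuclideanSpace ℝ (Fin d) => x i) :=
    (EuclideanSpace.proj (𝕜 := ℝ) i).contDiff
  exact hσ.comp this

lemma fd_act {σ : ℝ → ℝ} (hσ : ContDiff ℝ 2 σ) {z : E → EuclideanSpace ℝ (Fin d)}
    (hz : ContDiff ℝ 2 z) (X p : E) (i : Fin d) :
    fderiv ℝ (fun Y => act σ (z Y)) X p i = deriv σ (z X i) * fderiv ℝ z X p i := by
  have hc : ContDiff ℝ 2 (fun Y => act σ (z Y)) := (act_contDiff hσ).comp hz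
  have h1 := fd_clm (EuclideanSpace.proj (𝕜 := ℝ) i) hc X p
  have h2 := fd_clm (EuclideanSpace.proj (𝕜 := ℝ) i) hz X p
  simp only [PiLp.proj_apply] at h1 h2
  have hzi : ContDiff ℝ 2 (fun Y => z Y i) := (EuclideanSpace.proj (𝕜 := ℝ) i).contDiff.comp hz
  rw [← h1, ← h2]
  have := fd_comp hσ hzi X p
  simp only [act]
  rw [this, fderiv_eq_smul_deriv, smul_eq_mul, mul_comm]

lemma sd_act {σ : ℝ → ℝ} (hσ : ContDiff ℝ 2 σ) {z : E → EuclideanSpace ℝ (Fin d)}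
    (hz : ContDiff ℝ 2 z) (X p q : E) (i : Fin d) :
    sd (fun Y => act σ (z Y)) X p q i =
      deriv (deriv σ) (z X i) * (fderiv ℝ z X q i * fderiv ℝ z X p i)
        + deriv σ (z X i) * sd z X p q i := by
  have hc : ContDiff ℝ 2 (fun Y => act σ (z Y)) := (act_contDiff hσ).comp hz
  have h1 := sd_clm (EuclideanSpace.proj (𝕜 := ℝ) i) hc X p q
  have h2 := sd_clm (EuclideanSpace.proj (𝕜 := ℝ) i) hz X p q
  have h3 := fd_clm (EuclideanSpace.proj (𝕜 := ℝ) i) hz X p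
  have h4 := fd_clm (EuclideanSpace.proj (𝕜 := ℝ) i) hz X q
  simp only [PiLp.proj_apply] at h1 h2 h3 h4
  have hzi : ContDiff ℝ 2 (fun Y => z Y i) := (EuclideanSpace.proj (𝕜 := ℝ) i).contDiff.comp hz
  rw [← h1, ← h2, ← h3, ← h4]
  have := sd_comp hσ hzi X p q
  simp only [act]
  rw [this, fderiv_eq_smul_deriv, smul_eq_mul, iteratedFDeriv_two_apply]
  have e : fderiv ℝ σ = fun x => ContinuousLinearMap.toSpanSingleton ℝ (deriv σ x) := by
    funext x; ext; simp
  have hd : DifferentiableAt ℝ (fderiv ℝ σ) (z X i) :=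
    (hσ.fderiv_right (m := 1) (by norm_num)).differentiable (by norm_num) _
  have key : deriv (deriv σ) (z X i) = fderiv ℝ (fderiv ℝ σ) (z X i) 1 1 := by
    have : deriv σ = fun x => fderiv ℝ σ x 1 := by funext x; simp
    rw [this, ← fderiv_apply_one_eq_deriv]
    rw [(hd.hasFDerivAt.clm_apply (hasFDerivAt_const (1:ℝ) (z X i))).fderiv]
    simp
  rw [key]
  simp only [Matrix.cons_val_zero, Matrix.cons_val_one]
  set B := fderiv ℝ (fderiv ℝ σ) (z X i)
  have hB : ∀ a b : ℝ, B a b = a * b * B 1 1 := by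
    intro a b
    have : B a b = B (a • 1) (b • 1) := by simp
    rw [this, map_smul, map_smul]
    simp [mul_assoc]
    ring
  rw [hB]
  ring

lemma norm_mul_le' {x y : EuclideanSpace ℝ (Fin d)} (c : Fin d → ℝ) (hc : ∀ i, |c i| ≤ 1)
    (h : ∀ i, x i = c i * y i) : ‖x‖ ≤ ‖y‖ := by
  rw [EuclideanSpace.norm_eq, EuclideanSpace.norm_eq]
  apply Real.sqrt_le_sqrt
  apply Finset.sum_le_sum
  intro i _
  rw [h i, norm_mul, Real.norm_eq_abs]
  gcongr
  nlinarith [hc i, norm_nonneg (y i)]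

lemma norm_mul3_le {x y z : EuclideanSpace ℝ (Fin d)} (c : Fin d → ℝ) (hc : ∀ i, |c i| ≤ 1)
    (h : ∀ i, x i = c i * (y i * z i)) : ‖x‖ ≤ ‖y‖ * ‖z‖ := by
  have h1 : ‖x‖ ≤ ‖‖y‖ • z‖ := by
    rw [EuclideanSpace.norm_eq, EuclideanSpace.norm_eq]
    apply Real.sqrt_le_sqrt
    apply Finset.sum_le_sum
    intro i _
    rw [h i, norm_mul, norm_mul, Real.norm_eq_abs, PiLp.smul_apply, norm_smul, norm_norm]
    refine pow_le_pow_left₀ (by positivity) ?_ 2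
    have := PiLp.norm_apply_le y i
    have h2 : ‖y i‖ * ‖z i‖ ≤ ‖y‖ * ‖z i‖ := by gcongr
    nlinarith [hc i, norm_nonneg (y i), norm_nonneg (z i), mul_nonneg (norm_nonneg (y i)) (norm_nonneg (z i))]
  rwa [norm_smul, norm_norm] at h1

end Calculus
section Layer

variable {E : Type*} [NormedAddCommGroup E] [NormedSpace ℝ E]

/-- pre-activation of one layer. -/
def preact (𝒜 : Matrix (Fin n) (Fin n) ℝ)
    (Ω W : EuclideanSpace ℝ (Fin d) →L[ℝ] EuclideanSpace ℝ (Fin d))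
    (ψ : EuclideanSpace ℝ (Fin d) × EuclideanSpace ℝ (Fin d) → EuclideanSpace ℝ (Fin d))
    (h : Fin n → E → EuclideanSpace ℝ (Fin d)) (i : Fin n) (Y : E) : EuclideanSpace ℝ (Fin d) :=
  Ω (h i Y) + W (∑ j : Fin n, 𝒜 i j • ψ (h i Y, h j Y))

lemma msg_contDiff (𝒜 : Matrix (Fin n) (Fin n) ℝ)
    {ψ : EuclideanSpace ℝ (Fin d) × EuclideanSpace ℝ (Fin d) → EuclideanSpace ℝ (Fin d)}
    (hψ : ContDiff ℝ 2 ψ)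
    {h : Fin n → E → EuclideanSpace ℝ (Fin d)} (hh : ∀ i, ContDiff ℝ 2 (h i)) (i j : Fin n) :
    ContDiff ℝ 2 (fun Y => 𝒜 i j • ψ (h i Y, h j Y)) :=
  (hψ.comp ((hh i).prodMk (hh j))).const_smul _

lemma msgs_contDiff (𝒜 : Matrix (Fin n) (Fin n) ℝ)
    {ψ : EuclideanSpace ℝ (Fin d) × EuclideanSpace ℝ (Fin d) → EuclideanSpace ℝ (Fin d)}
    (hψ : ContDiff ℝ 2 ψ)
    {h : Fin n → E → EuclideanSpace ℝ (Fin d)} (hh : ∀ i, ContDiff ℝ 2 (h i)) (i : Fin n) :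
    ContDiff ℝ 2 (fun Y => ∑ j : Fin n, 𝒜 i j • ψ (h i Y, h j Y)) :=
  ContDiff.sum (fun j _ => msg_contDiff 𝒜 hψ hh i j)

lemma preact_contDiff (𝒜 : Matrix (Fin n) (Fin n) ℝ)
    (Ω W : EuclideanSpace ℝ (Fin d) →L[ℝ] EuclideanSpace ℝ (Fin d))
    {ψ : EuclideanSpace ℝ (Fin d) × EuclideanSpace ℝ (Fin d) → EuclideanSpace ℝ (Fin d)}
    (hψ : ContDiff ℝ 2 ψ)
    {h : Fin n → E → EuclideanSpace ℝ (Fin d)} (hh : ∀ i, ContDiff ℝ 2 (h i)) (i : Fin n) :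
    ContDiff ℝ 2 (preact 𝒜 Ω W ψ h i) :=
  (Ω.contDiff.comp (hh i)).add (W.contDiff.comp (msgs_contDiff 𝒜 hψ hh i))

/-- the linear part of one layer. -/
def linStep (𝒜 : Matrix (Fin n) (Fin n) ℝ)
    (Ω W : EuclideanSpace ℝ (Fin d) →L[ℝ] EuclideanSpace ℝ (Fin d))
    (ψ : EuclideanSpace ℝ (Fin d) × EuclideanSpace ℝ (Fin d) → EuclideanSpace ℝ (Fin d))
    (x : Fin n → EuclideanSpace ℝ (Fin d)) (p : Fin n → EuclideanSpace ℝ (Fin d)) (i : Fin n) :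
    EuclideanSpace ℝ (Fin d) :=
  Ω (p i) + W (∑ j : Fin n, 𝒜 i j • fderiv ℝ ψ (x i, x j) (p i, p j))

lemma fd_preact (𝒜 : Matrix (Fin n) (Fin n) ℝ)
    (Ω W : EuclideanSpace ℝ (Fin d) →L[ℝ] EuclideanSpace ℝ (Fin d))
    {ψ : EuclideanSpace ℝ (Fin d) × EuclideanSpace ℝ (Fin d) → EuclideanSpace ℝ (Fin d)}
    (hψ : ContDiff ℝ 2 ψ)
    {h : Fin n → E → EuclideanSpace ℝ (Fin d)} (hh : ∀ i, ContDiff ℝ 2 (h i)) (i : Fin n)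
    (X p : E) :
    fderiv ℝ (preact 𝒜 Ω W ψ h i) X p =
      linStep 𝒜 Ω W ψ (fun j => h j X) (fun j => fderiv ℝ (h j) X p) i := by
  have e : preact 𝒜 Ω W ψ h i =
      fun Y => Ω (h i Y) + W (∑ j : Fin n, 𝒜 i j • ψ (h i Y, h j Y)) := rfl
  rw [e, fd_add (f := fun Y => Ω (h i Y))
    (g := fun Y => W (∑ j : Fin n, 𝒜 i j • ψ (h i Y, h j Y))) (Ω.contDiff.comp (hh i)) (W.contDiff.comp (msgs_contDiff 𝒜 hψ hh i)),
    fd_clm Ω (hh i), fd_clm W (msgs_contDiff 𝒜 hψ hh i),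
    fd_sum _ (fun j => msg_contDiff 𝒜 hψ hh i j)]
  unfold linStep
  congr 2
  refine Finset.sum_congr rfl fun j _ => ?_
  have h1 : ContDiff ℝ 2 (fun Y => (h i Y, h j Y)) := (hh i).prodMk (hh j)
  have h2 := fd_clm (𝒜 i j • ContinuousLinearMap.id ℝ (EuclideanSpace ℝ (Fin d)))
    (hψ.comp h1) X p
  have h3 := fd_comp hψ h1 X p
  simp only [ContinuousLinearMap.smul_apply, ContinuousLinearMap.id_apply,
    Function.comp_apply] at h2
  rw [h2]
  change 𝒜 i j • fderiv ℝ (fun Y => ψ (h i Y, h j Y)) X p = _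
  rw [h3, fd_prod (hh i) (hh j)]

lemma sd_preact (𝒜 : Matrix (Fin n) (Fin n) ℝ)
    (Ω W : EuclideanSpace ℝ (Fin d) →L[ℝ] EuclideanSpace ℝ (Fin d))
    {ψ : EuclideanSpace ℝ (Fin d) × EuclideanSpace ℝ (Fin d) → EuclideanSpace ℝ (Fin d)}
    (hψ : ContDiff ℝ 2 ψ)
    {h : Fin n → E → EuclideanSpace ℝ (Fin d)} (hh : ∀ i, ContDiff ℝ 2 (h i)) (i : Fin n)
    (X p q : E) :
    sd (preact 𝒜 Ω W ψ h i) X p q =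
      linStep 𝒜 Ω W ψ (fun j => h j X) (fun j => sd (h j) X p q) i
      + W (∑ j : Fin n, 𝒜 i j • iteratedFDeriv ℝ 2 ψ (h i X, h j X)
          ![(fderiv ℝ (h i) X q, fderiv ℝ (h j) X q), (fderiv ℝ (h i) X p, fderiv ℝ (h j) X p)]) := by
  have e : preact 𝒜 Ω W ψ h i =
      fun Y => Ω (h i Y) + W (∑ j : Fin n, 𝒜 i j • ψ (h i Y, h j Y)) := rfl
  rw [e, sd_add (f := fun Y => Ω (h i Y))
    (g := fun Y => W (∑ j : Fin n, 𝒜 i j • ψ (h i Y, h j Y))) (Ω.contDiff.comp (hh i)) (W.contDiff.comp (msgs_contDiff 𝒜 hψ hh i)),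
    sd_clm Ω (hh i), sd_clm W (msgs_contDiff 𝒜 hψ hh i),
    sd_sum _ (fun j => msg_contDiff 𝒜 hψ hh i j)]
  unfold linStep
  rw [add_assoc, ← map_add, ← Finset.sum_add_distrib]
  congr 2
  refine Finset.sum_congr rfl fun j _ => ?_
  have h1 : ContDiff ℝ 2 (fun Y => (h i Y, h j Y)) := (hh i).prodMk (hh j)
  have h2 := sd_clm (𝒜 i j • ContinuousLinearMap.id ℝ (EuclideanSpace ℝ (Fin d)))
    (hψ.comp h1) X p q
  have h3 := sd_comp hψ h1 X p q
  simp only [ContinuousLinearMap.smul_apply, ContinuousLinearMap.id_apply,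
    Function.comp_apply] at h2
  rw [h2]
  change 𝒜 i j • sd (fun Y => ψ (h i Y, h j Y)) X p q = _
  rw [h3, sd_prod (hh i) (hh j), fd_prod (hh i) (hh j), fd_prod (hh i) (hh j), smul_add, add_comm]

lemma linStep_le {𝒜 : Matrix (Fin n) (Fin n) ℝ} (h𝒜 : ∀ i j, 0 ≤ 𝒜 i j) {γ : ℝ}
    (hrow : ∀ i, ∑ j, 𝒜 i j ≤ γ)
    {Ω W : EuclideanSpace ℝ (Fin d) →L[ℝ] EuclideanSpace ℝ (Fin d)}
    {ω w : ℝ} (hw : 0 < w) (hw1 : w ≤ 1) (hΩ : ‖Ω‖ ≤ ω) (hW : ‖W‖ ≤ w)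
    {ψ : EuclideanSpace ℝ (Fin d) × EuclideanSpace ℝ (Fin d) → EuclideanSpace ℝ (Fin d)}
    (hψ : ContDiff ℝ 2 ψ) {c₁ c₂ : ℝ}
    (hψ₁ : ∀ x y, ‖fderiv ℝ (fun z => ψ (z, y)) x‖ ≤ c₁)
    (hψ₂ : ∀ x y, ‖fderiv ℝ (fun z => ψ (x, z)) y‖ ≤ c₂)
    (hcap : ω / w + c₁ * γ + c₂ ≤ 1) (hγ : 0 ≤ γ)
    (x p : Fin n → EuclideanSpace ℝ (Fin d)) (i : Fin n) :
    ‖linStep 𝒜 Ω W ψ x p i‖ ≤ (1 - c₂) * ‖p i‖ + c₂ * ∑ j, 𝒜 i j * ‖p j‖ := by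
  have hc1 : 0 ≤ c₁ := (norm_nonneg _).trans (hψ₁ 0 0)
  have hc2 : 0 ≤ c₂ := (norm_nonneg _).trans (hψ₂ 0 0)
  have hω : 0 ≤ ω := (norm_nonneg _).trans hΩ
  have h1 : ‖Ω (p i)‖ ≤ ω * ‖p i‖ := Ω.le_of_opNorm_le hΩ _
  have h2 : ‖∑ j : Fin n, 𝒜 i j • fderiv ℝ ψ (x i, x j) (p i, p j)‖
      ≤ ∑ j, 𝒜 i j * (c₁ * ‖p i‖ + c₂ * ‖p j‖) := by
    refine (norm_sum_le _ _).trans (Finset.sum_le_sum fun j _ => ?_)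
    rw [norm_smul, Real.norm_of_nonneg (h𝒜 i j), fd_partial hψ]
    refine mul_le_mul_of_nonneg_left ((norm_add_le _ _).trans ?_) (h𝒜 i j)
    exact add_le_add (ContinuousLinearMap.le_of_opNorm_le _ (hψ₁ _ _) _)
      (ContinuousLinearMap.le_of_opNorm_le _ (hψ₂ _ _) _)
  have h3 : ∑ j, 𝒜 i j * (c₁ * ‖p i‖ + c₂ * ‖p j‖)
      = (∑ j, 𝒜 i j) * (c₁ * ‖p i‖) + c₂ * ∑ j, 𝒜 i j * ‖p j‖ := by
    rw [Finset.sum_mul, Finset.mul_sum, ← Finset.sum_add_distrib]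
    exact Finset.sum_congr rfl fun j _ => by ring
  have h4 : (∑ j, 𝒜 i j) * (c₁ * ‖p i‖) ≤ γ * (c₁ * ‖p i‖) :=
    mul_le_mul_of_nonneg_right (hrow i) (by positivity)
  set T := ∑ j, 𝒜 i j * ‖p j‖ with hT
  have hT0 : 0 ≤ T := Finset.sum_nonneg fun j _ => mul_nonneg (h𝒜 i j) (norm_nonneg _)
  have h5 : ‖W (∑ j : Fin n, 𝒜 i j • fderiv ℝ ψ (x i, x j) (p i, p j))‖
      ≤ w * (γ * (c₁ * ‖p i‖) + c₂ * T) := by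
    refine (W.le_of_opNorm_le hW _).trans (mul_le_mul_of_nonneg_left ?_ hw.le)
    linarith
  have h6 : ω + w * (c₁ * γ) ≤ 1 - c₂ := by
    have h7 : 0 ≤ c₁ * γ := mul_nonneg hc1 hγ
    have h8 : 0 ≤ ω / w := div_nonneg hω hw.le
    have h9 : ω = w * (ω / w) := by field_simp
    nlinarith
  have h10 : w * (c₂ * T) ≤ c₂ * T := by
    have : 0 ≤ c₂ * T := mul_nonneg hc2 hT0
    nlinarith
  refine (norm_add_le _ _).trans ?_
  nlinarith [mul_le_mul_of_nonneg_right h6 (norm_nonneg (p i))]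

lemma layer_fd_le {𝒜 : Matrix (Fin n) (Fin n) ℝ}
    {σ : ℝ → ℝ} (hσ : ContDiff ℝ 2 σ) (hσ' : ∀ x, |deriv σ x| ≤ 1)
    {Ω W : EuclideanSpace ℝ (Fin d) →L[ℝ] EuclideanSpace ℝ (Fin d)}
    {ψ : EuclideanSpace ℝ (Fin d) × EuclideanSpace ℝ (Fin d) → EuclideanSpace ℝ (Fin d)}
    (hψ : ContDiff ℝ 2 ψ)
    {h : Fin n → E → EuclideanSpace ℝ (Fin d)} (hh : ∀ i, ContDiff ℝ 2 (h i)) (i : Fin n)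
    (X p : E) :
    ‖fderiv ℝ (fun Y => act σ (preact 𝒜 Ω W ψ h i Y)) X p‖ ≤
      ‖linStep 𝒜 Ω W ψ (fun j => h j X) (fun j => fderiv ℝ (h j) X p) i‖ := by
  rw [← fd_preact 𝒜 Ω W hψ hh]
  exact norm_mul_le' _ (fun k => hσ' _) (fd_act hσ (preact_contDiff 𝒜 Ω W hψ hh i) X p)

lemma layer_sd_le {𝒜 : Matrix (Fin n) (Fin n) ℝ} (h𝒜 : ∀ i j, 0 ≤ 𝒜 i j)
    {σ : ℝ → ℝ} (hσ : ContDiff ℝ 2 σ) (hσ' : ∀ x, |deriv σ x| ≤ 1)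
    (hσ'' : ∀ x, |deriv (deriv σ) x| ≤ 1)
    {Ω W : EuclideanSpace ℝ (Fin d) →L[ℝ] EuclideanSpace ℝ (Fin d)} (hW : ‖W‖ ≤ 1)
    {ψ : EuclideanSpace ℝ (Fin d) × EuclideanSpace ℝ (Fin d) → EuclideanSpace ℝ (Fin d)}
    (hψ : ContDiff ℝ 2 ψ) {c2 : ℝ} (hψ₃ : ∀ p, ‖iteratedFDeriv ℝ 2 ψ p‖ ≤ c2)
    {h : Fin n → E → EuclideanSpace ℝ (Fin d)} (hh : ∀ i, ContDiff ℝ 2 (h i)) (i : Fin n)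
    (X p q : E) :
    ‖sd (fun Y => act σ (preact 𝒜 Ω W ψ h i Y)) X p q‖ ≤
      ‖linStep 𝒜 Ω W ψ (fun j => h j X) (fun j => sd (h j) X p q) i‖
      + ‖linStep 𝒜 Ω W ψ (fun j => h j X) (fun j => fderiv ℝ (h j) X q) i‖
        * ‖linStep 𝒜 Ω W ψ (fun j => h j X) (fun j => fderiv ℝ (h j) X p) i‖
      + c2 * ∑ j, 𝒜 i j * ((‖fderiv ℝ (h i) X q‖ + ‖fderiv ℝ (h j) X q‖)
          * (‖fderiv ℝ (h i) X p‖ + ‖fderiv ℝ (h j) X p‖)) := by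
  have hc : 0 ≤ c2 := (norm_nonneg _).trans (hψ₃ 0)
  rw [← fd_preact 𝒜 Ω W hψ hh, ← fd_preact 𝒜 Ω W hψ hh]
  have hz := preact_contDiff 𝒜 Ω W hψ hh i
  have key := sd_act hσ hz X p q
  set a : EuclideanSpace ℝ (Fin d) := WithLp.toLp 2 (fun k =>
    deriv (deriv σ) (preact 𝒜 Ω W ψ h i X k) * (fderiv ℝ (preact 𝒜 Ω W ψ h i) X q k *
      fderiv ℝ (preact 𝒜 Ω W ψ h i) X p k)) with ha
  set b : EuclideanSpace ℝ (Fin d) := WithLp.toLp 2 (fun k =>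
    deriv σ (preact 𝒜 Ω W ψ h i X k) * sd (preact 𝒜 Ω W ψ h i) X p q k) with hb
  have e : sd (fun Y => act σ (preact 𝒜 Ω W ψ h i Y)) X p q = a + b := by
    ext k
    rw [key]
    rfl
  have ha' := norm_mul3_le (x := a) _ (fun k => hσ'' (preact 𝒜 Ω W ψ h i X k)) (fun k => rfl)
  have hb' := norm_mul_le' (x := b) _ (fun k => hσ' (preact 𝒜 Ω W ψ h i X k)) (fun k => rfl)
  have hs : ‖sd (preact 𝒜 Ω W ψ h i) X p q‖ ≤
      ‖linStep 𝒜 Ω W ψ (fun j => h j X) (fun j => sd (h j) X p q) i‖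
      + c2 * ∑ j, 𝒜 i j * ((‖fderiv ℝ (h i) X q‖ + ‖fderiv ℝ (h j) X q‖)
          * (‖fderiv ℝ (h i) X p‖ + ‖fderiv ℝ (h j) X p‖)) := by
    rw [sd_preact 𝒜 Ω W hψ hh]
    refine (norm_add_le _ _).trans (add_le_add le_rfl ?_)
    refine (W.le_of_opNorm_le hW _).trans ?_
    rw [one_mul, Finset.mul_sum]
    refine (norm_sum_le _ _).trans (Finset.sum_le_sum fun j _ => ?_)
    rw [norm_smul, Real.norm_of_nonneg (h𝒜 i j)]
    have hp : ∀ x y : EuclideanSpace ℝ (Fin d), ‖(x, y)‖ ≤ ‖x‖ + ‖y‖ := fun x y => by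
      rw [Prod.norm_mk]
      exact max_le (by linarith [norm_nonneg y]) (by linarith [norm_nonneg x])
    have h1 := (iteratedFDeriv ℝ 2 ψ (h i X, h j X)).le_of_opNorm_le (hψ₃ _)
      ![(fderiv ℝ (h i) X q, fderiv ℝ (h j) X q), (fderiv ℝ (h i) X p, fderiv ℝ (h j) X p)]
    rw [Fin.prod_univ_two] at h1
    simp only [Matrix.cons_val_zero, Matrix.cons_val_one] at h1
    have h2 : ‖(fderiv ℝ (h i) X q, fderiv ℝ (h j) X q)‖ * ‖(fderiv ℝ (h i) X p, fderiv ℝ (h j) X p)‖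
      ≤ (‖fderiv ℝ (h i) X q‖ + ‖fderiv ℝ (h j) X q‖)
          * (‖fderiv ℝ (h i) X p‖ + ‖fderiv ℝ (h j) X p‖) :=
      mul_le_mul (hp _ _) (hp _ _) (norm_nonneg _) (by positivity)
    calc _ ≤ 𝒜 i j * (c2 * ((‖fderiv ℝ (h i) X q‖ + ‖fderiv ℝ (h j) X q‖)
          * (‖fderiv ℝ (h i) X p‖ + ‖fderiv ℝ (h j) X p‖))) :=
          mul_le_mul_of_nonneg_left (h1.trans (mul_le_mul_of_nonneg_left h2 hc)) (h𝒜 i j)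
      _ = _ := by ring
  rw [e]
  have := norm_add_le a b
  linarith

end Layer
section Global

lemma mpnn_succ (σ : ℝ → ℝ) (𝒜 : Matrix (Fin n) (Fin n) ℝ)
    (Ω W : ℕ → EuclideanSpace ℝ (Fin d) →L[ℝ] EuclideanSpace ℝ (Fin d))
    (ψ : ℕ → EuclideanSpace ℝ (Fin d) × EuclideanSpace ℝ (Fin d) → EuclideanSpace ℝ (Fin d))
    (t : ℕ) (i : Fin n) :
    (fun X => mpnn σ 𝒜 Ω W ψ (t + 1) X i) =
      fun X => act σ (preact 𝒜 (Ω (t+1)) (W (t+1)) (ψ (t+1))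
        (fun j Y => mpnn σ 𝒜 Ω W ψ t Y j) i X) := rfl

lemma mpnn_contDiff {σ : ℝ → ℝ} (hσ : ContDiff ℝ 2 σ) (𝒜 : Matrix (Fin n) (Fin n) ℝ)
    (Ω W : ℕ → EuclideanSpace ℝ (Fin d) →L[ℝ] EuclideanSpace ℝ (Fin d))
    {ψ : ℕ → EuclideanSpace ℝ (Fin d) × EuclideanSpace ℝ (Fin d) → EuclideanSpace ℝ (Fin d)}
    (hψ : ∀ t, ContDiff ℝ 2 (ψ t)) (t : ℕ) (i : Fin n) :
    ContDiff ℝ 2 (fun X => mpnn σ 𝒜 Ω W ψ t X i) := by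
  induction t generalizing i with
  | zero => exact contDiff_apply ℝ (EuclideanSpace ℝ (Fin d)) i
  | succ t ih =>
    rw [mpnn_succ]
    exact (act_contDiff hσ).comp (preact_contDiff 𝒜 _ _ (hψ _) ih i)

lemma fd_mpnn_zero (σ : ℝ → ℝ) (𝒜 : Matrix (Fin n) (Fin n) ℝ)
    (Ω W : ℕ → EuclideanSpace ℝ (Fin d) →L[ℝ] EuclideanSpace ℝ (Fin d))
    (ψ : ℕ → EuclideanSpace ℝ (Fin d) × EuclideanSpace ℝ (Fin d) → EuclideanSpace ℝ (Fin d))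
    (i : Fin n) (X p : Fin n → EuclideanSpace ℝ (Fin d)) :
    fderiv ℝ (fun Y => mpnn σ 𝒜 Ω W ψ 0 Y i) X p = p i := by
  have : (fun Y => mpnn σ 𝒜 Ω W ψ 0 Y i) =
    (ContinuousLinearMap.proj (R := ℝ) (φ := fun _ : Fin n => EuclideanSpace ℝ (Fin d)) i) := rfl
  rw [this, ContinuousLinearMap.fderiv]
  rfl

/-- the lazy walk matrix `(1-c)I + c 𝒜`. -/
def lazy (c : ℝ) (𝒜 : Matrix (Fin n) (Fin n) ℝ) : Matrix (Fin n) (Fin n) ℝ :=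
  (1 - c) • (1 : Matrix (Fin n) (Fin n) ℝ) + c • 𝒜

lemma lazy_mulVec (c : ℝ) (𝒜 : Matrix (Fin n) (Fin n) ℝ) (x : Fin n → ℝ) (i : Fin n) :
    (lazy c 𝒜).mulVec x i = (1 - c) * x i + c * ∑ j, 𝒜 i j * x j := by
  rw [lazy, Matrix.add_mulVec, Matrix.smul_mulVec, Matrix.smul_mulVec, Matrix.one_mulVec]
  rfl

lemma lazy_pow_succ (c : ℝ) (𝒜 : Matrix (Fin n) (Fin n) ℝ) (t : ℕ) (i u : Fin n) :
    (lazy c 𝒜 ^ (t + 1)) i u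
      = (1 - c) * (lazy c 𝒜 ^ t) i u + c * ∑ j, 𝒜 i j * (lazy c 𝒜 ^ t) j u := by
  rw [pow_succ', ← lazy_mulVec c 𝒜 (fun j => (lazy c 𝒜 ^ t) j u)]
  rfl

lemma main_generic {𝒜 : Matrix (Fin n) (Fin n) ℝ} (h𝒜 : ∀ i j, 0 ≤ 𝒜 i j)
    (hsymm : 𝒜.transpose = 𝒜) {γ : ℝ}
    (hrow : ∀ i, ∑ j, 𝒜 i j ≤ γ) (hγ : 0 ≤ γ)
    (g : Fin n → ℝ) (hg1 : ∀ i, 1 ≤ g i) (hgγ : ∀ i, g i ≤ γ)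
    (hgA : ∀ i, ∑ j, 𝒜 i j * g j = g i)
    {σ : ℝ → ℝ} (hσ : ContDiff ℝ 2 σ)
    (hσ' : ∀ x, |deriv σ x| ≤ 1) (hσ'' : ∀ x, |deriv (deriv σ) x| ≤ 1)
    {Ω W : ℕ → EuclideanSpace ℝ (Fin d) →L[ℝ] EuclideanSpace ℝ (Fin d)}
    {ω w : ℝ} (hw : 0 < w) (hΩ : ∀ t, ‖Ω t‖ ≤ ω) (hW : ∀ t, ‖W t‖ ≤ w)
    {ψ : ℕ → EuclideanSpace ℝ (Fin d) × EuclideanSpace ℝ (Fin d) → EuclideanSpace ℝ (Fin d)}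
    (hψ : ∀ t, ContDiff ℝ 2 (ψ t)) {c₁ c₂ c2 : ℝ}
    (hψ₁ : ∀ t x y, ‖fderiv ℝ (fun z => ψ t (z, y)) x‖ ≤ c₁)
    (hψ₂ : ∀ t x y, ‖fderiv ℝ (fun z => ψ t (x, z)) y‖ ≤ c₂)
    (hψ₃ : ∀ t p, ‖iteratedFDeriv ℝ 2 (ψ t) p‖ ≤ c2)
    (hw1 : w ≤ 1) (hcap : ω / w + c₁ * γ + c₂ ≤ 1)
    {θ : EuclideanSpace ℝ (Fin d)} (hθ : ‖θ‖ = 1)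
    (m : ℕ) (v u : Fin n) (X : Fin n → EuclideanSpace ℝ (Fin d)) (α β : Fin d) :
    |mixEntry θ σ 𝒜 Ω W ψ m v u X α β| ≤
      γ * ∑ k ∈ Finset.range m, ((lazy c₂ 𝒜 ^ (2 * k + 2)) v u
        + 2 * c2 * ((γ • (1 : Matrix (Fin n) (Fin n) ℝ) + 𝒜) * lazy c₂ 𝒜 ^ (2 * k)) v u) := by
  have hc1 : 0 ≤ c₁ := (norm_nonneg _).trans (hψ₁ 0 0 0)
  have hc2 : 0 ≤ c₂ := (norm_nonneg _).trans (hψ₂ 0 0 0)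
  have hc2' : 0 ≤ c2 := (norm_nonneg _).trans (hψ₃ 0 0)
  have hω : 0 ≤ ω := (norm_nonneg _).trans (hΩ 0)
  have hc21 : 0 ≤ 1 - c₂ := by
    have := mul_nonneg hc1 hγ
    have := div_nonneg hω hw.le
    linarith
  set Z := lazy c₂ 𝒜 with hZ
  have hpow : ∀ t i j, 0 ≤ (Z ^ t) i j := by
    intro t
    induction t with
    | zero => intro i j; rw [pow_zero, Matrix.one_apply]; split_ifs <;> norm_num
    | succ t ih =>
      intro i j
      rw [hZ, lazy_pow_succ]
      exact add_nonneg (mul_nonneg hc21 (ih i j))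
        (mul_nonneg hc2 (Finset.sum_nonneg fun k _ => mul_nonneg (h𝒜 i k) (ih k j)))
  have hstep : ∀ (t : ℕ) (x p : Fin n → EuclideanSpace ℝ (Fin d)) (i : Fin n),
      ‖linStep 𝒜 (Ω t) (W t) (ψ t) x p i‖ ≤ (1 - c₂) * ‖p i‖ + c₂ * ∑ j, 𝒜 i j * ‖p j‖ :=
    fun t x p i => linStep_le h𝒜 hrow hw hw1 (hΩ t) (hW t) (hψ t) (hψ₁ t) (hψ₂ t) hcap hγ x p i
  have hC := fun t i => mpnn_contDiff hσ 𝒜 Ω W hψ t i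
  -- first derivative bound
  have hmono : ∀ (t : ℕ) (b : Fin n) (x p : Fin n → EuclideanSpace ℝ (Fin d)) (k : ℕ),
      (∀ j, ‖p j‖ ≤ (Z ^ t) j b) →
      ∀ i, ‖linStep 𝒜 (Ω k) (W k) (ψ k) x p i‖ ≤ (Z ^ (t + 1)) i b := by
    intro t b x p k hp i
    refine (hstep k x p i).trans ?_
    rw [hZ, lazy_pow_succ, ← hZ]
    refine add_le_add (mul_le_mul_of_nonneg_left (hp i) hc21)
      (mul_le_mul_of_nonneg_left (Finset.sum_le_sum fun j _ => ?_) hc2)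
    exact mul_le_mul_of_nonneg_left (hp j) (h𝒜 i j)
  have hJ : ∀ (b : Fin n) (δ : Fin d) (t : ℕ) (i : Fin n),
      ‖fderiv ℝ (fun Y => mpnn σ 𝒜 Ω W ψ t Y i) X (dir b δ)‖ ≤ (Z ^ t) i b := by
    intro b δ t
    induction t with
    | zero =>
      intro i
      rw [fd_mpnn_zero, pow_zero, Matrix.one_apply, dir]
      by_cases hib : i = b
      · subst hib; simp
      · simp [hib]
    | succ t ih =>
      intro i
      rw [mpnn_succ]
      refine (layer_fd_le hσ hσ' (hψ _) (hC t) i X _).trans ?_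
      exact hmono t b _ _ _ ih i
  -- second derivative
  set R : ℕ → Fin n → ℝ := fun t i => (Z ^ (t+1)) i v * (Z ^ (t+1)) i u
    + c2 * ∑ j, 𝒜 i j * (((Z ^ t) i v + (Z ^ t) j v) * ((Z ^ t) i u + (Z ^ t) j u)) with hR
  set H : ℕ → Fin n → ℝ := fun t i =>
    ‖sd (fun Y => mpnn σ 𝒜 Ω W ψ t Y i) X (dir u β) (dir v α)‖ with hH
  have hH0 : ∀ i, H 0 i = 0 := by
    intro i
    simp only [hH, sd, fd_mpnn_zero]
    simp
  have hHs : ∀ t i, H (t+1) i ≤ (1 - c₂) * H t i + c₂ * ∑ j, 𝒜 i j * H t j + R t i := by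
    intro t i
    simp only [hH]
    rw [mpnn_succ]
    refine (layer_sd_le h𝒜 hσ hσ' hσ'' ((hW _).trans hw1) (hψ _) (hψ₃ _) (hC t) i X _ _).trans ?_
    rw [add_assoc]
    refine add_le_add (hstep _ _ _ _) (add_le_add ?_ ?_)
    · exact mul_le_mul (hmono t v _ _ _ (hJ v α t) i) (hmono t u _ _ _ (hJ u β t) i)
        (norm_nonneg _) (hpow _ _ _)
    · refine mul_le_mul_of_nonneg_left (Finset.sum_le_sum fun j _ => ?_) hc2'
      refine mul_le_mul_of_nonneg_left ?_ (h𝒜 i j)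
      exact mul_le_mul (add_le_add (hJ v α t i) (hJ v α t j)) (add_le_add (hJ u β t i) (hJ u β t j))
        (by positivity) (add_nonneg (hpow _ _ _) (hpow _ _ _))
  have hA' : ∀ i j, 𝒜 i j = 𝒜 j i := fun i j => congrFun (congrFun hsymm j) i
  have hR0 : ∀ t i, 0 ≤ R t i := fun t i =>
    add_nonneg (mul_nonneg (hpow _ _ _) (hpow _ _ _)) (mul_nonneg hc2' (Finset.sum_nonneg fun j _ =>
      mul_nonneg (h𝒜 i j) (mul_nonneg (add_nonneg (hpow _ _ _) (hpow _ _ _))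
        (add_nonneg (hpow _ _ _) (hpow _ _ _)))))
  have hL : ∀ t, ∑ i, g i * H t i ≤ γ * ∑ k ∈ Finset.range t, ∑ i, R k i := by
    intro t
    induction t with
    | zero => simp [hH0]
    | succ t ih =>
      rw [Finset.sum_range_succ, mul_add]
      have h1 : ∑ i, g i * H (t+1) i ≤
          ∑ i, (g i * ((1 - c₂) * H t i + c₂ * ∑ j, 𝒜 i j * H t j) + γ * R t i) := by
        refine Finset.sum_le_sum fun i _ => ?_
        have h2 := mul_le_mul_of_nonneg_left (hHs t i) (zero_le_one.trans (hg1 i))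
        have h3 := mul_le_mul_of_nonneg_right (hgγ i) (hR0 t i)
        linarith
      have h4 : ∑ i, g i * ∑ j, 𝒜 i j * H t j = ∑ i, g i * H t i := by
        simp_rw [Finset.mul_sum]
        rw [Finset.sum_comm]
        refine Finset.sum_congr rfl fun j _ => ?_
        rw [← hgA j, Finset.sum_mul]
        refine Finset.sum_congr rfl fun i _ => ?_
        rw [hA' i j]; ring
      have h5 : ∑ i, (g i * ((1 - c₂) * H t i + c₂ * ∑ j, 𝒜 i j * H t j) + γ * R t i)
          = (1 - c₂) * ∑ i, g i * H t i + c₂ * ∑ i, g i * ∑ j, 𝒜 i j * H t j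
            + γ * ∑ i, R t i := by
        rw [Finset.mul_sum, Finset.mul_sum, Finset.mul_sum, ← Finset.sum_add_distrib,
          ← Finset.sum_add_distrib]
        exact Finset.sum_congr rfl fun i _ => by ring
      rw [h5, h4] at h1
      linarith
  have hZs : ∀ t, (Z ^ t).transpose = Z ^ t := by
    intro t
    rw [Matrix.transpose_pow]
    congr 1
    simp [hZ, lazy, hsymm]
  have hZs' : ∀ t i j, (Z ^ t) i j = (Z ^ t) j i := fun t i j =>
    congrFun (congrFun (hZs t) j) i
  have hcommA : ∀ t, 𝒜 * Z ^ t = Z ^ t * 𝒜 := by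
    intro t
    refine Commute.pow_right ?_ t
    simp only [hZ, lazy]
    exact ((Commute.one_right 𝒜).smul_right _).add_right ((Commute.refl 𝒜).smul_right _)
  have hRk : ∀ k, ∑ i, R k i ≤ (Z ^ (2 * k + 2)) v u
        + 2 * c2 * ((γ • (1 : Matrix (Fin n) (Fin n) ℝ) + 𝒜) * Z ^ (2 * k)) v u := by
    intro k
    have e1 : ∑ i, (Z ^ (k+1)) i v * (Z ^ (k+1)) i u = (Z ^ (2 * k + 2)) v u := by
      rw [show 2 * k + 2 = (k+1) + (k+1) by ring, pow_add Z (k+1) (k+1), Matrix.mul_apply]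
      exact Finset.sum_congr rfl fun i _ => by rw [hZs' (k+1) i v]
    have e2 : ∑ i, (Z ^ k) i v * (Z ^ k) i u = (Z ^ (2 * k)) v u := by
      rw [two_mul, pow_add, Matrix.mul_apply]
      exact Finset.sum_congr rfl fun i _ => by rw [hZs' k i v]
    have e3 : ∑ i, ∑ j, 𝒜 i j * ((Z ^ k) i v * (Z ^ k) j u) = (𝒜 * Z ^ (2 * k)) v u := by
      rw [two_mul, pow_add, ← mul_assoc, hcommA, mul_assoc, Matrix.mul_apply]
      refine Finset.sum_congr rfl fun i _ => ?_
      rw [Matrix.mul_apply, Finset.mul_sum]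
      exact Finset.sum_congr rfl fun j _ => by rw [hZs' k i v]; ring
    have e4 : ∑ i, ∑ j, 𝒜 i j * ((Z ^ k) j v * (Z ^ k) i u) = (𝒜 * Z ^ (2 * k)) v u := by
      rw [← e3, Finset.sum_comm]
      exact Finset.sum_congr rfl fun i _ => Finset.sum_congr rfl fun j _ => by rw [hA' j i]
    have e5 : ∑ i, ∑ j, 𝒜 i j * ((Z ^ k) i v * (Z ^ k) i u) ≤ γ * (Z ^ (2 * k)) v u := by
      rw [← e2, Finset.mul_sum]
      refine Finset.sum_le_sum fun i _ => ?_
      rw [← Finset.sum_mul]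
      exact mul_le_mul_of_nonneg_right (hrow i) (mul_nonneg (hpow _ _ _) (hpow _ _ _))
    have e6 : ∑ i, ∑ j, 𝒜 i j * ((Z ^ k) j v * (Z ^ k) j u) ≤ γ * (Z ^ (2 * k)) v u := by
      refine le_of_eq_of_le ?_ e5
      rw [Finset.sum_comm]
      exact Finset.sum_congr rfl fun i _ => Finset.sum_congr rfl fun j _ => by rw [hA' j i]
    have e7 : ∑ i, R k i = ∑ i, (Z ^ (k+1)) i v * (Z ^ (k+1)) i u
        + c2 * (∑ i, ∑ j, 𝒜 i j * ((Z ^ k) i v * (Z ^ k) i u)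
          + ∑ i, ∑ j, 𝒜 i j * ((Z ^ k) i v * (Z ^ k) j u)
          + ∑ i, ∑ j, 𝒜 i j * ((Z ^ k) j v * (Z ^ k) i u)
          + ∑ i, ∑ j, 𝒜 i j * ((Z ^ k) j v * (Z ^ k) j u)) := by
      simp only [hR]
      rw [Finset.sum_add_distrib, ← Finset.mul_sum]
      congr 2
      simp only [← Finset.sum_add_distrib]
      exact Finset.sum_congr rfl fun i _ => Finset.sum_congr rfl fun j _ => by ring
    have e8 : ((γ • (1 : Matrix (Fin n) (Fin n) ℝ) + 𝒜) * Z ^ (2 * k)) v u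
        = γ * (Z ^ (2 * k)) v u + (𝒜 * Z ^ (2 * k)) v u := by
      simp [add_mul]
    rw [e7, e8, e1, e3, e4]
    have := mul_le_mul_of_nonneg_left (add_le_add e5 e6) hc2'
    linarith
  -- assemble
  have hmix : mixEntry θ σ 𝒜 Ω W ψ m v u X α β =
      inner ℝ θ (∑ i, sd (fun Y => mpnn σ 𝒜 Ω W ψ m Y i) X (dir u β) (dir v α)) := by
    have e1 : readout θ σ 𝒜 Ω W ψ m =
        fun Y => innerSL ℝ θ (∑ i, mpnn σ 𝒜 Ω W ψ m Y i) := by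
      funext Y
      rw [innerSL_apply_apply, PiLp.inner_apply]
      simp only [readout, RCLike.inner_apply, conj_trivial]
      exact Finset.sum_congr rfl fun x _ => mul_comm _ _
    have e2 : mixEntry θ σ 𝒜 Ω W ψ m v u X α β =
      sd (readout θ σ 𝒜 Ω W ψ m) X (dir u β) (dir v α) := rfl
    rw [e2, e1, sd_clm (innerSL ℝ θ) (ContDiff.sum fun i _ => hC m i), sd_sum _ (hC m)]
    rfl
  calc |mixEntry θ σ 𝒜 Ω W ψ m v u X α β|
      ≤ ‖∑ i, sd (fun Y => mpnn σ 𝒜 Ω W ψ m Y i) X (dir u β) (dir v α)‖ := by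
        rw [hmix]
        refine (abs_real_inner_le_norm _ _).trans ?_
        rw [hθ, one_mul]
    _ ≤ ∑ i, H m i := norm_sum_le _ _
    _ ≤ ∑ i, g i * H m i := Finset.sum_le_sum fun i _ => by
        have : 0 ≤ H m i := norm_nonneg _
        nlinarith [hg1 i]
    _ ≤ γ * ∑ k ∈ Finset.range m, ∑ i, R k i := hL m
    _ ≤ _ := mul_le_mul_of_nonneg_left (Finset.sum_le_sum fun k _ => hRk k) hγ

end Global
section Spectral

lemma spec_mul (M : Matrix (Fin n) (Fin n) ℝ) (φ : Fin n → Fin n → ℝ) (μ c : Fin n → ℝ)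
    (h : ∀ ℓ, M.mulVec (φ ℓ) = μ ℓ • φ ℓ) (s : Finset (Fin n)) :
    M * Matrix.of (fun a b => ∑ ℓ ∈ s, c ℓ * (φ ℓ a * φ ℓ b)) =
      Matrix.of (fun a b => ∑ ℓ ∈ s, (c ℓ * μ ℓ) * (φ ℓ a * φ ℓ b)) := by
  ext a b
  simp only [Matrix.mul_apply, Matrix.of_apply, Finset.mul_sum]
  rw [Finset.sum_comm]
  refine Finset.sum_congr rfl fun ℓ _ => ?_
  have := congrFun (h ℓ) a
  simp only [Matrix.mulVec, dotProduct, Pi.smul_apply, smul_eq_mul] at this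
  calc ∑ x, M a x * (c ℓ * (φ ℓ x * φ ℓ b)) = (c ℓ * φ ℓ b) * ∑ x, M a x * φ ℓ x := by
        rw [Finset.mul_sum]; exact Finset.sum_congr rfl fun x _ => by ring
    _ = _ := by rw [this]; ring

lemma spec_one (φ : Fin n → Fin n → ℝ)
    (horth : ∀ k l, ∑ a, φ k a * φ l a = if k = l then (1 : ℝ) else 0) :
    Matrix.of (fun a b => ∑ ℓ, φ ℓ a * φ ℓ b) = (1 : Matrix (Fin n) (Fin n) ℝ) := by
  have h1 : (Matrix.of φ) * (Matrix.of φ).transpose = (1 : Matrix (Fin n) (Fin n) ℝ) := by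
    ext k l
    simp [Matrix.mul_apply, Matrix.one_apply, horth]
  have h2 := mul_eq_one_comm.mp h1
  rw [← h2]
  ext a b
  simp [Matrix.mul_apply]

lemma spectral_sum (hn : 0 < n) (L : Matrix (Fin n) (Fin n) ℝ) (lam : Fin n → ℝ)
    (φ : Fin n → Fin n → ℝ)
    (horth : ∀ k l, ∑ a, φ k a * φ l a = if k = l then (1 : ℝ) else 0)
    (heig : ∀ ℓ, L.mulVec (φ ℓ) = lam ℓ • φ ℓ)
    (hlam0 : lam ⟨0, hn⟩ = 0)
    (hlampos : ∀ ℓ : Fin n, (ℓ : ℕ) ≠ 0 → 0 < lam ℓ)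
    (hlamlt : ∀ ℓ, lam ℓ < 2) (c : ℝ) (hc : 0 < c) (hc1 : c ≤ 1) (m : ℕ)
    (P Z : Matrix (Fin n) (Fin n) ℝ) (hZ : Z = 1 - c • L)
    (hP : P = Matrix.of (fun a b => φ ⟨0, hn⟩ a * φ ⟨0, hn⟩ b)) :
    L * P = 0 ∧
    ∑ k ∈ Finset.range m, Z ^ (2 * k) =
      (m : ℝ) • P + (1 / c) • ((1 - Z ^ (2 * m)) * (1 + Z)⁻¹ * nLapPinv lam φ) := by
  have hLP : L * P = 0 := by
    have := spec_mul L φ lam (fun _ => 1) heig {⟨0, hn⟩}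
    simp only [Finset.sum_singleton, one_mul, hlam0, zero_mul] at this
    rw [hP, this]; rfl
  refine ⟨hLP, ?_⟩
  have hlam2 : ∀ ℓ, 0 < 2 - c * lam ℓ := by
    intro ℓ
    have : c * lam ℓ < c * 2 := mul_lt_mul_of_pos_left (hlamlt ℓ) hc
    linarith
  -- invertibility
  have hinv : IsUnit (1 + Z).det := by
    have h1 : ∀ ℓ, (1 + Z).mulVec (φ ℓ) = (2 - c * lam ℓ) • φ ℓ := by
      intro ℓ
      rw [hZ, Matrix.add_mulVec, Matrix.sub_mulVec, Matrix.smul_mulVec, heig, Matrix.one_mulVec]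
      ext a
      simp only [Pi.add_apply, Pi.sub_apply, Pi.smul_apply, smul_eq_mul]
      ring
    have h2 := spec_mul (1 + Z) φ _ (fun ℓ => (2 - c * lam ℓ)⁻¹) h1 Finset.univ
    simp only [inv_mul_cancel₀ (hlam2 _).ne', one_mul, spec_one φ horth] at h2
    exact Matrix.isUnit_det_of_right_inverse h2
  have hpinv : L * nLapPinv lam φ = 1 - P := by
    unfold nLapPinv
    rw [spec_mul L φ lam (fun ℓ => 1 / lam ℓ) heig, ← spec_one φ horth, hP]
    ext a b
    simp only [Matrix.sub_apply, Matrix.of_apply]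
    rw [eq_sub_iff_add_eq, ← Finset.sum_filter_add_sum_filter_not Finset.univ
      (fun ℓ : Fin n => (ℓ : ℕ) ≠ 0)]
    congr 1
    · refine Finset.sum_congr rfl fun ℓ hℓ => ?_
      have := (hlampos ℓ (Finset.mem_filter.mp hℓ).2).ne'
      field_simp
    · have : Finset.univ.filter (fun ℓ : Fin n => ¬ (ℓ : ℕ) ≠ 0) = {⟨0, hn⟩} := by
        ext ℓ; simp [Fin.ext_iff]
      rw [this, Finset.sum_singleton]
  have hZP : Z * P = P := by
    rw [hZ, sub_mul, one_mul, Matrix.smul_mul, hLP, smul_zero, sub_zero]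
  have hZkP : ∀ k, Z ^ k * P = P := by
    intro k
    induction k with
    | zero => simp
    | succ k ih => rw [pow_succ, mul_assoc, hZP, ih]
  have hgeo : (1 - Z ^ (2 * m)) =
      (∑ k ∈ Finset.range m, Z ^ (2 * k)) * (c • L) * (1 + Z) := by
    have h1 := geom_sum_mul_neg (Z ^ 2) m
    simp_rw [← pow_mul] at h1
    rw [← h1, mul_assoc]
    congr 1
    have : c • L = 1 - Z := by rw [hZ]; abel
    rw [this]
    noncomm_ring
  rw [hgeo, Matrix.mul_nonsing_inv_cancel_right _ _ hinv, mul_assoc, Matrix.smul_mul, hpinv,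
    Matrix.mul_smul, smul_smul, one_div, inv_mul_cancel₀ hc.ne', one_smul, mul_sub, mul_one,
    Finset.sum_mul]
  simp only [hZkP]
  rw [Finset.sum_const, Finset.card_range, Nat.cast_smul_eq_nsmul]
  abel

end Spectral
section Graph

lemma Asym_apply (G : SimpleGraph (Fin n)) [DecidableRel G.Adj] (i j : Fin n) :
    Asym G i j = if G.Adj i j then (Real.sqrt (G.degree i))⁻¹ * (Real.sqrt (G.degree j))⁻¹ else 0 := by
  unfold Asym
  rw [Matrix.mul_diagonal, Matrix.diagonal_mul, SimpleGraph.adjMatrix_apply]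
  split_ifs <;> simp

lemma Asym_nonneg (G : SimpleGraph (Fin n)) [DecidableRel G.Adj] (i j : Fin n) :
    0 ≤ Asym G i j := by
  rw [Asym_apply]
  split_ifs <;> positivity

lemma Asym_symm (G : SimpleGraph (Fin n)) [DecidableRel G.Adj] :
    (Asym G).transpose = Asym G := by
  ext i j
  rw [Matrix.transpose_apply, Asym_apply, Asym_apply]
  simp only [G.adj_comm i j, mul_comm]

lemma Asym_sqrt (G : SimpleGraph (Fin n)) [DecidableRel G.Adj] (hpos : ∀ i, 0 < G.degree i)
    (i : Fin n) : ∑ j, Asym G i j * Real.sqrt (G.degree j) = Real.sqrt (G.degree i) := by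
  have hs : ∀ j, 0 < Real.sqrt (G.degree j) := fun j =>
    Real.sqrt_pos.mpr (by exact_mod_cast hpos j)
  have h1 : ∀ j, Asym G i j * Real.sqrt (G.degree j)
      = if G.Adj i j then (Real.sqrt (G.degree i))⁻¹ else 0 := by
    intro j
    rw [Asym_apply]
    split_ifs
    · rw [mul_assoc, inv_mul_cancel₀ (hs j).ne', mul_one]
    · simp
  simp_rw [h1]
  rw [← Finset.sum_filter, Finset.sum_const, ← G.neighborFinset_eq_filter,
    G.card_neighborFinset_eq_degree, nsmul_eq_mul]
  rw [← div_eq_mul_inv, Real.div_sqrt]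

end Graph
/-- Theorem C.1: pseudo-inverse form of the mixing bound for `𝒜 = A_sym`. -/
theorem mixing_bound_pseudoinverse (hn : 0 < n)
    (G : SimpleGraph (Fin n)) [DecidableRel G.Adj] (hconn : G.Connected)
    (σ : ℝ → ℝ) (hσ : ContDiff ℝ 2 σ)
    (hσ' : ∀ x, |deriv σ x| ≤ 1) (hσ'' : ∀ x, |deriv (deriv σ) x| ≤ 1)
    (Ω W : ℕ → EuclideanSpace ℝ (Fin d) →L[ℝ] EuclideanSpace ℝ (Fin d))
    (ω w : ℝ) (hw : 0 < w) (hΩ : ∀ t, ‖Ω t‖ ≤ ω) (hW : ∀ t, ‖W t‖ ≤ w)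
    (ψ : ℕ → EuclideanSpace ℝ (Fin d) × EuclideanSpace ℝ (Fin d) → EuclideanSpace ℝ (Fin d))
    (hψ : ∀ t, ContDiff ℝ 2 (ψ t)) (c₁ c₂ c2 : ℝ) (hc₂ : 0 < c₂)
    (hψ₁ : ∀ t x y, ‖fderiv ℝ (fun z => ψ t (z, y)) x‖ ≤ c₁)
    (hψ₂ : ∀ t x y, ‖fderiv ℝ (fun z => ψ t (x, z)) y‖ ≤ c₂)
    (hψ₃ : ∀ t p, ‖iteratedFDeriv ℝ 2 (ψ t) p‖ ≤ c2)
    (γ : ℝ) (hγ : γ = Real.sqrt ((G.maxDegree : ℝ) / (G.minDegree : ℝ)))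
    (hw1 : w ≤ 1) (hcap : ω / w + c₁ * γ + c₂ ≤ 1)
    (lam : Fin n → ℝ) (φ : Fin n → Fin n → ℝ)
    (horth : ∀ k l, ∑ a, φ k a * φ l a = if k = l then (1 : ℝ) else 0)
    (heig : ∀ ℓ, (nLap G).mulVec (φ ℓ) = lam ℓ • φ ℓ)
    (hmono : Monotone lam)
    (hlam0 : lam ⟨0, hn⟩ = 0)
    (hlampos : ∀ ℓ : Fin n, (ℓ : ℕ) ≠ 0 → 0 < lam ℓ)
    (hlamlt : ∀ ℓ, lam ℓ < 2)
    (hφ0 : ∀ a, φ ⟨0, hn⟩ a = Real.sqrt ((G.degree a : ℝ) / (2 * G.edgeFinset.card)))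
    (θ : EuclideanSpace ℝ (Fin d)) (hθ : ‖θ‖ = 1)
    (m : ℕ) (v u : Fin n) (X : Fin n → EuclideanSpace ℝ (Fin d)) (α β : Fin d) :
    |OSQ.mixEntry θ σ (Asym G) Ω W ψ m v u X α β|
      ≤ γ * ((m : ℝ) * Real.sqrt ((G.degree v : ℝ) * (G.degree u : ℝ)) /
              (2 * (G.edgeFinset.card : ℝ)) * (1 + 2 * c2 * (1 + γ))
            + (1 / c₂) * ((Zmat c₂ G ^ 2 * (1 - Zmat c₂ G ^ (2 * m)) *
                (1 + Zmat c₂ G)⁻¹ * nLapPinv lam φ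
                  : Matrix (Fin n) (Fin n) ℝ) v u))
        + 2 * (c2 / c₂) * γ *
            (((((1 + γ) • (1 : Matrix (Fin n) (Fin n) ℝ)) - nLap G) *
              (1 - Zmat c₂ G ^ (2 * m)) * (1 + Zmat c₂ G)⁻¹ * nLapPinv lam φ
                : Matrix (Fin n) (Fin n) ℝ) v u) := by
  classical
  -- positivity of degrees
  have hntriv : Nontrivial (Fin n) := by
    by_contra hne
    rw [not_nontrivial_iff_subsingleton] at hne
    have hdeg : ∀ a, G.degree a = 0 := fun a => by
      rw [← G.card_neighborFinset_eq_degree, Finset.card_eq_zero, Finset.eq_empty_iff_forall_notMem]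
      intro b hb
      rw [SimpleGraph.mem_neighborFinset] at hb
      exact hb.ne (Subsingleton.elim _ _)
    have h1 := horth ⟨0, hn⟩ ⟨0, hn⟩
    simp [hφ0, hdeg] at h1
  have hdmin : 0 < G.minDegree := hconn.preconnected.minDegree_pos_of_nontrivial
  have hpos : ∀ i, 0 < G.degree i := fun i => hdmin.trans_le (G.minDegree_le_degree i)
  have hsmin : 0 < Real.sqrt (G.minDegree : ℝ) := Real.sqrt_pos.mpr (by exact_mod_cast hdmin)
  have hγ0 : 0 ≤ γ := by rw [hγ]; exact Real.sqrt_nonneg _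
  set g : Fin n → ℝ := fun i => Real.sqrt (G.degree i) / Real.sqrt G.minDegree with hg
  have hg1 : ∀ i, 1 ≤ g i := fun i => by
    rw [hg, le_div_iff₀ hsmin, one_mul]
    exact Real.sqrt_le_sqrt (by exact_mod_cast G.minDegree_le_degree i)
  have hgγ : ∀ i, g i ≤ γ := fun i => by
    rw [hγ, Real.sqrt_div (Nat.cast_nonneg _)]
    exact div_le_div_of_nonneg_right
      (Real.sqrt_le_sqrt (by exact_mod_cast G.degree_le_maxDegree i)) hsmin.le
  have hgA : ∀ i, ∑ j, Asym G i j * g j = g i := fun i => by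
    simp only [hg, ← mul_div_assoc]
    rw [← Finset.sum_div, Asym_sqrt G hpos]
  have hrow : ∀ i, ∑ j, Asym G i j ≤ γ := fun i => by
    refine le_trans ?_ ((hgA i).le.trans (hgγ i))
    exact Finset.sum_le_sum fun j _ => le_mul_of_one_le_right (Asym_nonneg G i j) (hg1 j)
  have hc1 : 0 ≤ c₁ := (norm_nonneg _).trans (hψ₁ 0 0 0)
  have hω : 0 ≤ ω := (norm_nonneg _).trans (hΩ 0)
  have hc21 : c₂ ≤ 1 := by
    have := mul_nonneg hc1 hγ0
    have := div_nonneg hω hw.le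
    linarith
  have hmain := main_generic (Asym_nonneg G) (Asym_symm G) hrow hγ0 g hg1 hgγ hgA hσ hσ' hσ''
    hw hΩ hW hψ hψ₁ hψ₂ hψ₃ hw1 hcap hθ m v u X α β
  refine hmain.trans (le_of_eq ?_)
  have hZ : lazy c₂ (Asym G) = Zmat c₂ G := by
    unfold lazy Zmat nLap
    module
  have hA : γ • (1 : Matrix (Fin n) (Fin n) ℝ) + Asym G
      = (1 + γ) • (1 : Matrix (Fin n) (Fin n) ℝ) - nLap G := by
    unfold nLap
    module
  rw [hZ, hA]
  set Z := Zmat c₂ G with hZdef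
  set P : Matrix (Fin n) (Fin n) ℝ :=
    Matrix.of (fun a b => φ ⟨0, hn⟩ a * φ ⟨0, hn⟩ b) with hP
  obtain ⟨hLP, hsum⟩ := spectral_sum hn (nLap G) lam φ horth heig hlam0 hlampos hlamlt c₂ hc₂ hc21 m
    P Z rfl rfl
  set L := nLap G with hL
  set Q := (1 - Z ^ (2 * m)) * (1 + Z)⁻¹ * nLapPinv lam φ with hQ
  have hZP : Z * P = P := by
    rw [hZdef, Zmat, sub_mul, one_mul, Matrix.smul_mul, ← hL, hLP, smul_zero, sub_zero]
  have hZ2P : Z ^ 2 * P = P := by rw [pow_two, mul_assoc, hZP, hZP]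
  have hPvu : P v u = Real.sqrt ((G.degree v : ℝ) * (G.degree u : ℝ)) /
      (2 * (G.edgeFinset.card : ℝ)) := by
    simp only [hP, Matrix.of_apply, hφ0]
    rw [Real.sqrt_div (Nat.cast_nonneg _), Real.sqrt_div (Nat.cast_nonneg _),
      Real.sqrt_mul (Nat.cast_nonneg _), div_mul_div_comm,
      Real.mul_self_sqrt (by positivity)]
  have e1 : ∑ k ∈ Finset.range m, Z ^ (2 * k + 2) = (m : ℝ) • P + (1 / c₂) • (Z ^ 2 * Q) := by
    have : ∑ k ∈ Finset.range m, Z ^ (2 * k + 2) = Z ^ 2 * ∑ k ∈ Finset.range m, Z ^ (2 * k) := by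
      rw [Finset.mul_sum]
      exact Finset.sum_congr rfl fun k _ => by rw [add_comm, pow_add]
    rw [this, hsum, mul_add, Matrix.mul_smul, Matrix.mul_smul, hZ2P]
  have e2 : ∑ k ∈ Finset.range m, (((1 + γ) • (1 : Matrix (Fin n) (Fin n) ℝ) - L) * Z ^ (2 * k))
      = ((m : ℝ) * (1 + γ)) • P
        + (1 / c₂) • (((1 + γ) • (1 : Matrix (Fin n) (Fin n) ℝ) - L) * Q) := by
    rw [← Finset.mul_sum, hsum, mul_add, Matrix.mul_smul, Matrix.mul_smul, sub_mul _ _ P, hLP,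
      Matrix.smul_mul, one_mul, sub_zero, smul_smul]
  have e1' := congrFun (congrFun e1 v) u
  have e2' := congrFun (congrFun e2 v) u
  rw [Matrix.sum_apply] at e1' e2'
  simp only [Matrix.add_apply, Matrix.smul_apply, smul_eq_mul] at e1' e2'
  have a1 : Z ^ 2 * (1 - Z ^ (2 * m)) * (1 + Z)⁻¹ * nLapPinv lam φ = Z ^ 2 * Q := by
    simp only [hQ, mul_assoc]
  have a2 : ((1 + γ) • (1 : Matrix (Fin n) (Fin n) ℝ) - L) * (1 - Z ^ (2 * m)) * (1 + Z)⁻¹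
      * nLapPinv lam φ = ((1 + γ) • (1 : Matrix (Fin n) (Fin n) ℝ) - L) * Q := by
    simp only [hQ, mul_assoc]
  rw [a1, a2, Finset.sum_add_distrib, ← Finset.mul_sum, e1', e2', mul_div_assoc, ← hPvu]
  ring
end OSQ
end
end
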